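/- arXiv:2309.10648 — 3 statements merged into one kernel-verified Lean document; each statement's English description precedes it below -/
import Mathlib

section
/- Let p, q ≥ 2 be integers and G_{p,q} = ⟨x, y | x^p = y^q⟩. Suppose g ∈ G_{p,q} has no nonzero central power, i.e. g^n ∉ Z(G_{p,q}) for all integers n ≠ 0 (equivalently, the inner automorphism ι_g has infinite order; equivalently, g is hyperbolic for the Bass–Serre action). Then the centralizer C(g) of g is isomorphic to ℤ × ℤ; moreover C(g) contains both g and the central element x^p. -/
/-- The torus knot group `⟨x, y | x^p = y^q⟩`, as the presented group obtained as the
quotient of the free group on two generators by the normal closure of `a^p * b^(-q)`. -/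
def TKG (p q : ℕ) : Type :=
  PresentedGroup ({FreeGroup.of true ^ p * (FreeGroup.of false ^ q)⁻¹} : Set (FreeGroup Bool))

instance TKG.instGroup (p q : ℕ) : Group (TKG p q) := by
  delta TKG; infer_instance

/-- The generator `x` of the torus knot group. -/
def TKx (p q : ℕ) : TKG p q := PresentedGroup.of true

/-- The generator `y` of the torus knot group. -/
def TKy (p q : ℕ) : TKG p q := PresentedGroup.of false

open Monoid

namespace TKaux

variable {ι : Type} {A : ι → Type} [∀ i, Group (A i)]

/-- Infinite reduced words. -/
structure Ray (A : ι → Type) [∀ i, Group (A i)] where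
  s : ℕ → (Σ i, A i)
  ne : ∀ n, (s n).2 ≠ 1
  alt : ∀ n, (s n).1 ≠ (s (n + 1)).1

theorem Ray.ext' {r r' : Ray A} (h : ∀ n, r.s n = r'.s n) : r = r' := by
  cases r; cases r'
  simp only [Ray.mk.injEq]
  exact funext h

/-- Prepend a letter. -/
def Ray.cons {i : ι} (a : A i) (ha : a ≠ 1) (r : Ray A) (h : (r.s 0).1 ≠ i) : Ray A where
  s n := Nat.casesOn n ⟨i, a⟩ r.s
  ne n := by cases n with
    | zero => exact ha
    | succ n => exact r.ne n
  alt n := by cases n with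
    | zero => exact h.symm
    | succ n => exact r.alt n

/-- Drop `n` letters. -/
def Ray.drop (r : Ray A) (n : ℕ) : Ray A where
  s m := r.s (m + n)
  ne m := r.ne _
  alt m := by
    have := r.alt (m + n)
    rwa [show m + 1 + n = m + n + 1 by omega]

/-- Rays whose first letter is not in the factor `i`. -/
abbrev Off (A : ι → Type) [∀ i, Group (A i)] (i : ι) := {r : Ray A // (r.s 0).1 ≠ i}

open Classical in
/-- Glue a (possibly trivial) head to a ray. -/
noncomputable def glue (i : ι) (x : A i × (Off A i × ℤ)) : Ray A × ℤ :=
  if h : x.1 = 1 then (x.2.1.1, x.2.2)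
  else (Ray.cons x.1 h x.2.1.1 x.2.1.2, x.2.2 + 1)

theorem glue_one (i : ι) (r : Off A i) (k : ℤ) : glue i (1, (r, k)) = (r.1, k) := by
  simp [glue]

theorem glue_ne (i : ι) (a : A i) (ha : a ≠ 1) (r : Off A i) (k : ℤ) :
    glue i (a, (r, k)) = (Ray.cons a ha r.1 r.2, k + 1) := by
  simp [glue, ha]

theorem cons_inj {i : ι} {a b : A i} {ha : a ≠ 1} {hb : b ≠ 1} {r r' : Ray A}
    {h : (r.s 0).1 ≠ i} {h' : (r'.s 0).1 ≠ i}
    (e : Ray.cons a ha r h = Ray.cons b hb r' h') : a = b ∧ r = r' := by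
  have e0 : ∀ n, (Ray.cons a ha r h).s n = (Ray.cons b hb r' h').s n := fun n => by rw [e]
  refine ⟨?_, Ray.ext' fun n => e0 (n + 1)⟩
  have := e0 0
  simpa [Ray.cons] using this

theorem cons_drop (r : Ray A) (h : ((r.drop 1).s 0).1 ≠ (r.s 0).1) :
    Ray.cons (r.s 0).2 (r.ne 0) (r.drop 1) h = r := by
  apply Ray.ext'
  intro n
  cases n <;> rfl

theorem glue_bij (i : ι) : Function.Bijective (glue (A := A) i) := by
  constructor
  · rintro ⟨a, r, k⟩ ⟨b, r', k'⟩ e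
    by_cases ha : a = 1 <;> by_cases hb : b = 1
    · subst ha; subst hb
      rw [glue_one, glue_one] at e
      simp only [Prod.mk.injEq] at e ⊢
      exact ⟨trivial, Subtype.ext e.1, e.2⟩
    · subst ha
      rw [glue_one, glue_ne i b hb] at e
      simp only [Prod.mk.injEq] at e
      exact absurd (by rw [e.1]; rfl) r.2
    · subst hb
      rw [glue_one, glue_ne i a ha] at e
      simp only [Prod.mk.injEq] at e
      exact absurd (by rw [← e.1]; rfl) r'.2
    · rw [glue_ne i a ha, glue_ne i b hb] at e
      simp only [Prod.mk.injEq] at e ⊢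
      have := cons_inj e.1
      exact ⟨this.1, Subtype.ext this.2, by omega⟩
  · rintro ⟨r, k⟩
    by_cases h : (r.s 0).1 = i
    · subst h
      have h1 : ((r.drop 1).s 0).1 ≠ (r.s 0).1 := (r.alt 0).symm
      refine ⟨((r.s 0).2, ⟨r.drop 1, h1⟩, k - 1), ?_⟩
      rw [glue_ne _ _ (r.ne 0), cons_drop]
      simp
    · exact ⟨(1, ⟨r, h⟩, k), glue_one _ _ _⟩

/-- Splitting off the head is an equivalence. -/
noncomputable def glueE (i : ι) : A i × (Off A i × ℤ) ≃ Ray A × ℤ := Equiv.ofBijective _ (glue_bij i)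

/-- Action of one factor. -/
noncomputable def actF (i : ι) : A i →* Equiv.Perm (Ray A × ℤ) where
  toFun a := (glueE i).permCongr ((Equiv.mulLeft a).prodCongr (Equiv.refl _))
  map_one' := by
    ext1 x
    obtain ⟨y, rfl⟩ := (glueE i).surjective x
    simp [Equiv.permCongr_apply]
  map_mul' a b := by
    ext1 x
    obtain ⟨y, rfl⟩ := (glueE i).surjective x
    obtain ⟨y1, y2⟩ := y
    simp [Equiv.permCongr_apply, mul_assoc]

theorem actF_glue (i : ι) (a b : A i) (x : Off A i × ℤ) :
    actF i a (glue i (b, x)) = glue i (a * b, x) := by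
  have : ∀ y, glue (A := A) i y = glueE i y := fun y => rfl
  rw [this, this]
  simp [actF, Equiv.permCongr_apply]

/-- Action of the free product on ends with height. -/
noncomputable def act : CoprodI A →* Equiv.Perm (Ray A × ℤ) := CoprodI.lift actF

theorem act_glue (i : ι) (a b : A i) (x : Off A i × ℤ) :
    act (CoprodI.of a) (glue i (b, x)) = glue i (a * b, x) := by
  rw [act, CoprodI.lift_of, actF_glue]

theorem act_off (i : ι) (a : A i) (r : Ray A) (h : (r.s 0).1 ≠ i) (k : ℤ) :
    act (CoprodI.of a) (r, k) = glue i (a, (⟨r, h⟩, k)) := by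
  have := act_glue i a 1 (⟨r, h⟩, k)
  rwa [glue_one, mul_one] at this

theorem glue_shift (i : ι) (a : A i) (r : Off A i) (k j : ℤ) :
    glue i (a, (r, k + j)) = ((glue i (a, (r, k))).1, (glue i (a, (r, k))).2 + j) := by
  by_cases ha : a = 1
  · subst ha; simp [glue_one]
  · simp [glue_ne i a ha]; ring

theorem act_shift (g : CoprodI A) : ∀ (w : Ray A) (k j : ℤ),
    act g (w, k + j) = ((act g (w, k)).1, (act g (w, k)).2 + j) := by
  induction g using CoprodI.induction_on with
  | one => intro w k j; simp
  | of i a =>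
    intro w k j
    obtain ⟨⟨b, r, l⟩, h⟩ := (glue_bij i).2 (w, k)
    have h2 : glue i (b, (r, l + j)) = (w, k + j) := by rw [glue_shift, h]
    rw [← h2, ← h, act_glue, act_glue, glue_shift]
  | mul x y hx hy =>
    intro w k j
    rw [map_mul, Equiv.Perm.mul_apply, Equiv.Perm.mul_apply, hy, hx]

/-- Prefix products. -/
def pre (s : ℕ → (Σ i, A i)) : ℕ → CoprodI A
  | 0 => 1
  | n + 1 => pre s n * CoprodI.of (s n).2

theorem pre_left (s : ℕ → (Σ i, A i)) (n : ℕ) :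
    pre s (n + 1) = CoprodI.of (s 0).2 * pre (fun m => s (m + 1)) n := by
  induction n with
  | zero => simp [pre]
  | succ n ih => rw [pre, ih, pre, mul_assoc]

theorem pre_add (s : ℕ → (Σ i, A i)) (m n : ℕ) :
    pre s (m + n) = pre s m * pre (fun k => s (m + k)) n := by
  induction n with
  | zero => simp [pre]
  | succ n ih => rw [← add_assoc, pre, ih, pre, mul_assoc]

/-- The tail relation. -/
def Rel (g : CoprodI A) (x y : Ray A × ℤ) : Prop :=
  ∃ N M : ℕ, (M : ℤ) - N = y.2 - x.2 ∧ (∀ n, y.1.s (M + n) = x.1.s (N + n)) ∧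
    g * pre x.1.s N = pre y.1.s M

theorem Rel.ext {g : CoprodI A} {x y : Ray A × ℤ} {N M : ℕ}
    (h : ∀ n, y.1.s (M + n) = x.1.s (N + n)) (e : g * pre x.1.s N = pre y.1.s M) (n : ℕ) :
    g * pre x.1.s (N + n) = pre y.1.s (M + n) := by
  rw [pre_add, pre_add, ← mul_assoc, e]
  congr 2
  funext k
  exact (h k).symm

theorem Rel.symm {g : CoprodI A} {x y : Ray A × ℤ} (h : Rel g x y) : Rel g⁻¹ y x := by
  obtain ⟨N, M, h1, h2, h3⟩ := h
  refine ⟨M, N, by omega, fun n => (h2 n).symm, ?_⟩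
  rw [← h3]; group

theorem Rel.trans {g g' : CoprodI A} {x y z : Ray A × ℤ} (h : Rel g x y) (h' : Rel g' y z) :
    Rel (g' * g) x z := by
  obtain ⟨N, M, h1, h2, h3⟩ := h
  obtain ⟨N', M', h1', h2', h3'⟩ := h'
  refine ⟨N + N', M' + M, by push_cast; omega, fun n => ?_, ?_⟩
  · rw [add_assoc, h2', add_assoc, ← h2]
    congr 1; omega
  · rw [mul_assoc, Rel.ext h2 h3, add_comm M, Rel.ext h2' h3']

theorem rel_glue (i : ι) (b : A i) (r : Off A i) (k : ℤ) :
    Rel (CoprodI.of b) (r.1, k) (glue i (b, (r, k))) := by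
  by_cases hb : b = 1
  · subst hb
    rw [glue_one]
    exact ⟨0, 0, by simp, fun n => rfl, by simp [pre]⟩
  · rw [glue_ne i b hb]
    refine ⟨0, 1, by simp, fun n => ?_, ?_⟩
    · simp only [Ray.cons]
      rw [add_comm 1 n, zero_add]
    · simp only [pre, mul_one, one_mul]
      rfl

theorem rel_act (g : CoprodI A) : ∀ x : Ray A × ℤ, Rel g x (act g x) := by
  induction g using CoprodI.induction_on with
  | one => intro x; exact ⟨0, 0, by simp, fun n => by simp, by simp [pre]⟩
  | of i a =>
    intro x
    obtain ⟨⟨b, r, l⟩, rfl⟩ := (glue_bij i).2 x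
    rw [act_glue]
    have := (rel_glue i b r l).symm.trans (rel_glue i (a * b) r l)
    simpa using this
  | mul x y hx hy =>
    intro w
    rw [map_mul, Equiv.Perm.mul_apply]
    exact (hy w).trans (hx _)

theorem act_free (g : CoprodI A) (x : Ray A × ℤ) (h : act g x = x) : g = 1 := by
  obtain ⟨N, M, h1, h2, h3⟩ := rel_act g x
  rw [h] at h1 h3
  have : N = M := by omega
  subst this
  simpa using h3

theorem act_pre (w : Ray A) (n : ℕ) : ∀ k : ℤ, act (pre w.s n) (w.drop n, k) = (w, k + n) := by
  induction n with
  | zero => intro k; simp [pre]; rfl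
  | succ n ih =>
    intro k
    have h : ((w.drop (n + 1)).s 0).1 ≠ (w.s n).1 := by
      have := w.alt n
      simpa [Ray.drop] using this.symm
    have e : Ray.cons (w.s n).2 (w.ne n) (w.drop (n + 1)) h = w.drop n := by
      apply Ray.ext'
      intro m
      cases m with
      | zero => simp [Ray.cons, Ray.drop]
      | succ m =>
        simp only [Ray.cons, Ray.drop]
        congr 1; omega
    rw [pre, map_mul, Equiv.Perm.mul_apply, act_off _ _ _ h, glue_ne _ _ (w.ne n)]
    simp only [e]
    rw [ih]
    push_cast
    congr 1; ring

/-- Agreement lemma. -/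
theorem agree (m : ℕ) : ∀ (r : Ray A) (s : Ray A) (k : ℤ), ∃ P : ℕ,
    (∀ n < P, (act (pre r.s m) (s, k)).1.s n = r.s n) ∧
    (act (pre r.s m) (s, k)).2 - k + m ≤ 2 * P + 1 ∧
    (1 ≤ (act (pre r.s m) (s, k)).2 - k + m →
      ((act (pre r.s m) (s, k)).1.s 0).1 = (r.s 0).1) := by
  induction m with
  | zero => intro r s k; exact ⟨0, by simp, by simp [pre], by simp [pre]⟩
  | succ m ih =>
    intro r s k
    obtain ⟨P, h1, h2, h3⟩ := ih (r.drop 1) s k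
    rw [pre_left, map_mul, Equiv.Perm.mul_apply]
    change (∀ n < P, (act (pre (fun m => r.s (m + 1)) m) (s, k)).1.s n = r.s (n + 1)) at h1
    change (act (pre (fun m => r.s (m + 1)) m) (s, k)).2 - k + m ≤ 2 * P + 1 at h2
    change (1 ≤ (act (pre (fun m => r.s (m + 1)) m) (s, k)).2 - k + m →
      ((act (pre (fun m => r.s (m + 1)) m) (s, k)).1.s 0).1 = (r.s 1).1) at h3
    generalize act (pre (fun m => r.s (m + 1)) m) (s, k) = y at *
    obtain ⟨t, k'⟩ := y
    simp only at h1 h2 h3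
    by_cases ht : (t.s 0).1 = (r.s 0).1
    · have hD : ¬ (1 ≤ k' - k + m) := fun hD => r.alt 0 (ht.symm.trans (h3 hD))
      refine ⟨0, by simp, ?_, ?_⟩
      all_goals
        obtain ⟨⟨b, v, l⟩, e⟩ := (glue_bij (r.s 0).1).2 (t, k')
        have hb : b ≠ 1 := by
          rintro rfl
          rw [glue_one] at e
          simp only [Prod.mk.injEq] at e
          exact v.2 (by rw [e.1, ht])
        rw [← e, act_glue]
        rw [glue_ne _ _ hb] at e
        simp only [Prod.mk.injEq] at e
        by_cases hc : (r.s 0).2 * b = 1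
        · rw [hc, glue_one]
          push_cast
          intros
          omega
        · rw [glue_ne _ _ hc]
          push_cast
          first | omega | (intro _; rfl)
    · rw [act_off _ _ _ ht, glue_ne _ _ (r.ne 0)]
      refine ⟨P + 1, ?_, by push_cast; omega, fun _ => rfl⟩
      intro n hn
      cases n with
      | zero => rfl
      | succ n => exact h1 n (by omega)

/-- The property we want. -/
def Good (h : CoprodI A) : Prop := ∃ f : CoprodI A → ℤ,
  (∀ c d, c * h = h * c → d * h = h * d → f (c * d) = f c + f d) ∧
  ∀ c, c * h = h * c → f c = 0 → c = 1

theorem good_conj {h : CoprodI A} (γ : CoprodI A) (H : Good h) : Good (γ * h * γ⁻¹) := by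
  obtain ⟨f, h1, h2⟩ := H
  have key : ∀ c, c * (γ * h * γ⁻¹) = (γ * h * γ⁻¹) * c → (γ⁻¹ * c * γ) * h = h * (γ⁻¹ * c * γ) := by
    intro c hc
    calc (γ⁻¹ * c * γ) * h = γ⁻¹ * (c * (γ * h * γ⁻¹)) * γ := by group
      _ = _ := by rw [hc]; group
  refine ⟨fun c => f (γ⁻¹ * c * γ), fun c d hc hd => ?_, fun c hc h0 => ?_⟩
  · rw [← h1 _ _ (key c hc) (key d hd)]
    congr 1; group
  · have := h2 _ (key c hc) h0
    have e : c = γ * (γ⁻¹ * c * γ) * γ⁻¹ := by group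
    rw [e, this]; group

theorem good_periodic (w : Ray A) (l : ℕ) (hl : 0 < l) (hw : ∀ n, w.s (n + l) = w.s n) :
    Good (pre w.s l) := by
  have hmul : ∀ n m, w.s (m + n * l) = w.s m := by
    intro n
    induction n with
    | zero => simp
    | succ n ih => intro m; rw [Nat.succ_mul, ← add_assoc, hw, ih]
  have hdrop : ∀ n, w.drop (n * l) = w := fun n => Ray.ext' (hmul n)
  have hpow : ∀ n, pre w.s (n * l) = pre w.s l ^ n := by
    intro n
    induction n with
    | zero => simp [pre]
    | succ n ih =>
      rw [Nat.succ_mul, pre_add, ih, pow_succ]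
      congr 2
      funext k
      rw [add_comm, hmul]
  have hact : ∀ (n : ℕ) (k : ℤ), act (pre w.s l ^ n) (w, k) = (w, k + n * l) := by
    intro n k
    have := act_pre w (n * l) k
    rw [hdrop, hpow] at this
    rw [this]; push_cast; rfl
  have fix : ∀ c, c * pre w.s l = pre w.s l * c → (act c (w, 0)).1 = w := by
    intro c hc
    apply Ray.ext'
    intro m
    have hcn : act (pre w.s l ^ (m + 1)) (act c (w, 0)) =
        ((act c (w, 0)).1, (act c (w, 0)).2 + ((m + 1 : ℕ) : ℤ) * l) := by
      have hcc : c * pre w.s l ^ (m + 1) = pre w.s l ^ (m + 1) * c :=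
        (show Commute c (pre w.s l) from hc).pow_right (m + 1)
      rw [← Equiv.Perm.mul_apply, ← map_mul, ← hcc, map_mul, Equiv.Perm.mul_apply, hact,
        act_shift]
    obtain ⟨P, h1, h2, -⟩ := agree ((m + 1) * l) w (act c (w, 0)).1 (act c (w, 0)).2
    rw [hpow, Prod.mk.eta, hcn] at h1 h2
    apply h1
    simp only at h2
    push_cast at h2
    have : ((m : ℤ) + 1) ≤ ((m : ℤ) + 1) * l := by nlinarith
    omega
  have fix' : ∀ c, c * pre w.s l = pre w.s l * c → act c (w, 0) = (w, (act c (w, 0)).2) :=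
    fun c hc => Prod.ext (fix c hc) rfl
  refine ⟨fun c => (act c (w, 0)).2, fun c d hc hd => ?_, fun c hc h0 => ?_⟩
  · simp only
    rw [map_mul, Equiv.Perm.mul_apply, fix' d hd]
    have := act_shift c w 0 (act d (w, 0)).2
    rw [zero_add] at this
    rw [this]
  · apply act_free c (w, 0)
    rw [fix' c hc]
    exact Prod.ext rfl h0

/-- Product of a list of letters. -/
def lp (L : List (Σ i, A i)) : CoprodI A := (L.map fun x => CoprodI.of x.2).prod

theorem exists_list (h : CoprodI A) : ∃ L, lp L = h := by
  induction h using CoprodI.induction_on with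
  | one => exact ⟨[], rfl⟩
  | of i a => exact ⟨[⟨i, a⟩], by simp [lp]⟩
  | mul x y hx hy =>
    obtain ⟨L, rfl⟩ := hx
    obtain ⟨L', rfl⟩ := hy
    exact ⟨L ++ L', by simp [lp]⟩

theorem lp_eq_pre (L : List (Σ i, A i)) : ∀ s : ℕ → (Σ i, A i),
    (∀ n (hn : n < L.length), s n = L[n]) → lp L = pre s L.length := by
  induction L with
  | nil => intro s _; rfl
  | cons a L ih =>
    intro s hs
    rw [List.length_cons, pre_left, ← ih (fun m => s (m + 1))]
    · have := hs 0 (by simp)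
      simp only [List.getElem_cons_zero] at this
      rw [this]; simp [lp]
    · intro n hn
      have := hs (n + 1) (by simpa using hn)
      simpa using this

theorem rotate_conj (L : List (Σ i, A i)) (n : ℕ) : ∃ γ, lp L = γ * lp (L.rotate n) * γ⁻¹ := by
  induction n with
  | zero => exact ⟨1, by simp⟩
  | succ n ih =>
    obtain ⟨γ, e⟩ := ih
    rw [← List.rotate_rotate]
    generalize L.rotate n = K at e
    cases K with
    | nil => exact ⟨γ, by simpa using e⟩
    | cons a K =>
      refine ⟨γ * CoprodI.of a.2, ?_⟩
      rw [e]
      simp [lp, mul_assoc]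

theorem good_or (h : CoprodI A) : h = 1 ∨ (∃ γ i, ∃ a : A i, h = γ * CoprodI.of a * γ⁻¹) ∨ Good h := by
  classical
  have ex : ∃ n, ∃ L : List (Σ i, A i), L.length = n ∧ ∃ γ, h = γ * lp L * γ⁻¹ := by
    obtain ⟨L, hL⟩ := exists_list h
    exact ⟨_, L, rfl, 1, by simp [hL]⟩
  obtain ⟨L, hL, γ, hγ⟩ := Nat.find_spec ex
  have hmin : ∀ L' : List (Σ i, A i), ∀ γ', h = γ' * lp L' * γ'⁻¹ → L.length ≤ L'.length := by
    intro L' γ' h'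
    rw [hL]
    exact Nat.find_min' ex ⟨L', rfl, γ', h'⟩
  clear hL
  rcases Nat.lt_or_ge L.length 2 with h2 | h2
  · match L, h2 with
    | [], _ => left; rw [hγ]; simp [lp]
    | [a], _ => right; left; exact ⟨γ, a.1, a.2, by rw [hγ]; simp [lp]⟩
  right; right
  have hpos : 0 < L.length := by omega
  let s : ℕ → (Σ i, A i) := fun n => L[n % L.length]'(Nat.mod_lt _ hpos)
  have hrot : ∀ n, ∃ T, L.rotate n = s n :: s (n + 1) :: T := by
    intro n
    have hlen : (L.rotate n).length = L.length := by simp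
    match hK : L.rotate n with
    | [] => simp [hK] at hlen; omega
    | [a] => simp [hK] at hlen; omega
    | a :: b :: T =>
      refine ⟨T, ?_⟩
      have h0 : (L.rotate n)[0]'(by omega) = s n := by
        rw [List.getElem_rotate]; simp [s]
      have h1 : (L.rotate n)[1]'(by omega) = s (n + 1) := by
        rw [List.getElem_rotate]; simp [s, add_comm]
      simp only [hK] at h0 h1
      simp at h0 h1
      rw [h0, h1]
  have hrot' : ∀ n L', lp L' = lp (L.rotate n) → L.length ≤ L'.length := by
    intro n L' e
    obtain ⟨δ, hδ⟩ := rotate_conj L n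
    apply hmin L' (γ * δ)
    rw [e, hγ, hδ]; group
  let w : Ray A :=
    { s := s
      ne := by
        intro n hn
        obtain ⟨T, hT⟩ := hrot n
        have h1 := hrot' n (s (n + 1) :: T) (by rw [hT]; simp [lp, hn])
        have h2 : (L.rotate n).length = L.length := by simp
        rw [hT] at h2
        simp at h1 h2
        omega
      alt := by
        intro n hn
        obtain ⟨T, hT⟩ := hrot n
        have h2 : (L.rotate n).length = L.length := by simp
        rw [hT] at h2
        have h1 : L.length ≤ T.length + 1 := by
          have hr := hrot' n
          rw [hT] at hr
          generalize s n = x at hr hn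
          generalize s (n + 1) = y at hr hn
          obtain ⟨i, a⟩ := x
          obtain ⟨j, b⟩ := y
          simp only at hn
          subst hn
          have := hr (⟨i, a * b⟩ :: T) (by simp [lp, mul_assoc])
          simpa using this
        simp at h2
        omega }
  rw [hγ]
  apply good_conj
  rw [lp_eq_pre L w.s]
  · apply good_periodic w _ hpos
    intro n
    simp [w, s]
  · intro n hn
    simp [w, s, Nat.mod_eq_of_lt hn]

end TKaux

namespace TKaux

/-- Orders of the two factors. -/
def ord (p q : ℕ) (b : Bool) : ℕ := if b then p else q

/-- The factors. -/
abbrev Fac (p q : ℕ) (b : Bool) : Type := Multiplicative (ZMod (ord p q b))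

/-- Hom out of a finite cyclic group. -/
theorem exists_zhom {K : Type} [Group K] (n : ℕ) (a : K) (ha : a ^ n = 1) :
    ∃ f : Multiplicative (ZMod n) →* K, f (Multiplicative.ofAdd 1) = a := by
  let f0 : ℤ →+ Additive K := (zmultiplesHom (Additive K)) (Additive.ofMul a)
  have h0 : f0 (n : ℤ) = 0 := by
    simp only [f0, zmultiplesHom_apply, natCast_zsmul]
    rw [← ofMul_pow, ha]; rfl
  let f1 : ZMod n →+ Additive K := ZMod.lift n ⟨f0, h0⟩
  refine ⟨AddMonoidHom.toMultiplicativeLeft f1, ?_⟩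
  have h1 : f1 ((1 : ℤ) : ZMod n) = f0 1 := ZMod.lift_coe n ⟨f0, h0⟩ 1
  rw [Int.cast_one] at h1
  change (f1 1).toMul = a
  rw [h1]
  simp [f0]

variable {p q : ℕ}

theorem fac_pow {b : Bool} (a : Fac p q b) : a ^ ord p q b = 1 := by
  apply Multiplicative.toAdd.injective
  rw [toAdd_pow]; simp

theorem hom_ext {K : Type} [Group K] {f g : TKG p q →* K}
    (hx : f (TKx p q) = g (TKx p q)) (hy : f (TKy p q) = g (TKy p q)) : f = g := by
  apply PresentedGroup.ext
  intro b
  cases b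
  · exact hy
  · exact hx

theorem exists_hom {K : Type} [Group K] (a b : K) (h : a ^ p = b ^ q) :
    ∃ f : TKG p q →* K, f (TKx p q) = a ∧ f (TKy p q) = b := by
  let F : Bool → K := fun t => if t then a else b
  have hF : ∀ r ∈ ({FreeGroup.of true ^ p * (FreeGroup.of false ^ q)⁻¹} : Set (FreeGroup Bool)),
      FreeGroup.lift F r = 1 := by
    intro r hr
    rw [Set.mem_singleton_iff] at hr
    subst hr
    simp [F, h]
  refine ⟨PresentedGroup.toGroup hF, ?_, ?_⟩
  · exact PresentedGroup.toGroup.of hF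
  · exact PresentedGroup.toGroup.of hF

theorem rel_xy : TKx p q ^ p = TKy p q ^ q := by
  have h := PresentedGroup.one_of_mem
    (rels := ({FreeGroup.of true ^ p * (FreeGroup.of false ^ q)⁻¹} : Set (FreeGroup Bool)))
    (Set.mem_singleton _)
  rw [map_mul, map_inv, map_pow, map_pow, mul_inv_eq_one] at h
  exact h

theorem z_central (g : TKG p q) : g * TKx p q ^ p = TKx p q ^ p * g := by
  have h : (MulAut.conj (TKx p q ^ p)).toMonoidHom = MonoidHom.id (TKG p q) := by
    apply hom_ext
    · simp only [MulEquiv.toMonoidHom_eq_coe, MonoidHom.coe_coe, MulAut.conj_apply,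
        MonoidHom.id_apply]
      group
    · simp only [MulEquiv.toMonoidHom_eq_coe, MonoidHom.coe_coe, MulAut.conj_apply,
        MonoidHom.id_apply]
      rw [rel_xy]
      group
  have h2 := DFunLike.congr_fun h g
  simp only [MulEquiv.toMonoidHom_eq_coe, MonoidHom.coe_coe, MulAut.conj_apply,
        MonoidHom.id_apply] at h2
  rw [mul_inv_eq_iff_eq_mul] at h2
  exact h2.symm

theorem z_mem_center : TKx p q ^ p ∈ Subgroup.center (TKG p q) :=
  Subgroup.mem_center_iff.2 z_central

theorem exists_proj : ∃ π : TKG p q →* CoprodI (Fac p q),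
    π (TKx p q ^ p) = 1 ∧ ∀ g, π g = 1 → ∃ n : ℤ, g = (TKx p q ^ p) ^ n := by
  have ht : (CoprodI.of (M := Fac p q) (i := true)
      (Multiplicative.ofAdd (1 : ZMod (ord p q true)))) ^ p = 1 := by
    rw [← map_pow]
    exact (congrArg _ (fac_pow (p := p) (q := q) (b := true) _)).trans (map_one _)
  have hf : (CoprodI.of (M := Fac p q) (i := false)
      (Multiplicative.ofAdd (1 : ZMod (ord p q false)))) ^ q = 1 := by
    rw [← map_pow]
    exact (congrArg _ (fac_pow (p := p) (q := q) (b := false) _)).trans (map_one _)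
  obtain ⟨π, hx, hy⟩ := exists_hom (p := p) (q := q) _ _ (ht.trans hf.symm)
  refine ⟨π, by rw [map_pow, hx, ht], ?_⟩
  let Z : Subgroup (TKG p q) := Subgroup.zpowers (TKx p q ^ p)
  have hZ : Z.Normal := by
    constructor
    rintro _ ⟨n, rfl⟩ g
    refine ⟨n, ?_⟩
    have : Commute g ((TKx p q ^ p) ^ n) := (show Commute g (TKx p q ^ p) from z_central g).zpow_right n
    change _ = g * (TKx p q ^ p) ^ n * g⁻¹
    rw [this.eq]; simp
  obtain ⟨ft, hft⟩ := exists_zhom p (QuotientGroup.mk' Z (TKx p q)) (by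
    rw [← map_pow]; exact (QuotientGroup.eq_one_iff _).2 (Subgroup.mem_zpowers _))
  obtain ⟨ff, hff⟩ := exists_zhom q (QuotientGroup.mk' Z (TKy p q)) (by
    rw [← map_pow, ← rel_xy]; exact (QuotientGroup.eq_one_iff _).2 (Subgroup.mem_zpowers _))
  let σ : CoprodI (Fac p q) →* TKG p q ⧸ Z :=
    CoprodI.lift (fun b => match b with
      | true => ft
      | false => ff)
  have hσ : σ.comp π = QuotientGroup.mk' Z := by
    apply hom_ext
    · rw [MonoidHom.comp_apply, hx, ← hft]
      exact CoprodI.lift_of _ _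
    · rw [MonoidHom.comp_apply, hy, ← hff]
      exact CoprodI.lift_of _ _
  intro g hg
  have h1 := DFunLike.congr_fun hσ g
  rw [MonoidHom.comp_apply, hg, map_one] at h1
  obtain ⟨n, hn⟩ := (QuotientGroup.eq_one_iff g).1 h1.symm
  exact ⟨n, hn.symm⟩

theorem exists_deg (hp : 2 ≤ p) (hq : 2 ≤ q) : ∃ θ : TKG p q →* Multiplicative ℤ,
    ∀ n : ℤ, θ ((TKx p q ^ p) ^ n) = 1 → n = 0 := by
  obtain ⟨θ, hx, hy⟩ := exists_hom (p := p) (q := q) (Multiplicative.ofAdd (q : ℤ))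
    (Multiplicative.ofAdd (p : ℤ)) (by
      rw [← ofAdd_nsmul, ← ofAdd_nsmul]; simp [mul_comm])
  refine ⟨θ, fun n hn => ?_⟩
  rw [map_zpow, map_pow, hx, ← ofAdd_nsmul, ← ofAdd_zsmul, ofAdd_eq_one] at hn
  simp only [smul_eq_mul, nsmul_eq_mul] at hn
  have h1 : (p : ℤ) * q ≠ 0 := by positivity
  exact (mul_eq_zero.1 hn).resolve_right h1

end TKaux

theorem TKG_hyperbolic_centralizer (p q : ℕ) (hp : 2 ≤ p) (hq : 2 ≤ q)
    (g : TKG p q) (hg : ∀ n : ℤ, n ≠ 0 → g ^ n ∉ Subgroup.center (TKG p q)) :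
    Nonempty (↥(Subgroup.centralizer {g}) ≃* Multiplicative (ℤ × ℤ)) ∧
    g ∈ Subgroup.centralizer {g} ∧
    TKx p q ^ p ∈ Subgroup.centralizer ({g} : Set (TKG p q)) := by
  have hgC : g ∈ Subgroup.centralizer {g} := by simp [Subgroup.mem_centralizer_singleton_iff]
  have hzC : TKx p q ^ p ∈ Subgroup.centralizer ({g} : Set (TKG p q)) := by
    rw [Subgroup.mem_centralizer_singleton_iff]
    exact (TKaux.z_central g).symm
  refine ⟨?_, hgC, hzC⟩
  obtain ⟨π, hπz, hπ⟩ := TKaux.exists_proj (p := p) (q := q)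
  obtain ⟨θ, hθ⟩ := TKaux.exists_deg (p := p) (q := q) hp hq
  have hinf : ∀ n : ℤ, n ≠ 0 → π g ^ n ≠ 1 := by
    intro n hn h
    rw [← map_zpow] at h
    obtain ⟨m, hm⟩ := hπ _ h
    apply hg n hn
    rw [hm]
    exact Subgroup.zpow_mem _ TKaux.z_mem_center m
  have good : TKaux.Good (π g) := by
    rcases TKaux.good_or (π g) with h | ⟨γ, b, a, h⟩ | h
    · exact absurd (by rw [h, one_zpow]) (hinf 1 one_ne_zero)
    · exfalso
      have h0 : TKaux.ord p q b ≠ 0 := by cases b <;> simp [TKaux.ord] <;> omega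
      apply hinf (TKaux.ord p q b) (by exact_mod_cast h0)
      have ha : a ^ TKaux.ord p q b = 1 := by
        exact TKaux.fac_pow a
      rw [zpow_natCast, h, conj_pow, ← map_pow, ha]
      simp
    · exact h
  obtain ⟨f, hf1, hf2⟩ := good
  have hcomm : ∀ c ∈ Subgroup.centralizer {g}, π c * π g = π g * π c := by
    intro c hc
    rw [Subgroup.mem_centralizer_singleton_iff] at hc
    rw [← map_mul, ← map_mul, hc]
  let ψ : ↥(Subgroup.centralizer {g}) →* Multiplicative ℤ := MonoidHom.mk'
    (fun c => Multiplicative.ofAdd (f (π c.1))) (by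
      intro c d
      rw [← ofAdd_add, ← hf1 _ _ (hcomm _ c.2) (hcomm _ d.2), ← map_mul]
      rfl)
  have hψ : ∀ c, ψ c = 1 → ∃ n : ℤ, c.1 = (TKx p q ^ p) ^ n := by
    intro c hc
    apply hπ
    apply hf2 _ (hcomm _ c.2)
    exact hc
  let z : ↥(Subgroup.centralizer {g}) := ⟨TKx p q ^ p, hzC⟩
  have hψz : ψ z = 1 := by
    change Multiplicative.ofAdd (f (π (TKx p q ^ p))) = 1
    have := hf1 1 1 (by simp) (by simp)
    rw [mul_one] at this
    rw [hπz, ofAdd_eq_one]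
    omega
  have hzc : ∀ c : ↥(Subgroup.centralizer {g}), Commute c z := fun c =>
    Subtype.ext (TKaux.z_central c.1)
  have hψg : ψ ⟨g, hgC⟩ ≠ 1 := by
    intro h
    obtain ⟨n, hn⟩ := hψ _ h
    apply hg 1 one_ne_zero
    rw [zpow_one]
    simp only at hn
    rw [hn]
    exact Subgroup.zpow_mem _ TKaux.z_mem_center n
  obtain ⟨d, hd⟩ := (inferInstance : IsCyclic ψ.range)
  obtain ⟨c0, hcd⟩ := d.2
  have hgen : ∀ c, ∃ n : ℤ, ψ c = ψ c0 ^ n := by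
    intro c
    obtain ⟨n, hn⟩ := hd ⟨ψ c, c, rfl⟩
    exact ⟨n, by rw [hcd]; exact (congrArg Subtype.val hn).symm⟩
  have hc0 : ψ c0 ≠ 1 := by
    intro h
    obtain ⟨n, hn⟩ := hgen ⟨g, hgC⟩
    rw [h, one_zpow] at hn
    exact hψg hn
  let E : Multiplicative (ℤ × ℤ) →* ↥(Subgroup.centralizer {g}) := MonoidHom.mk'
    (fun v => c0 ^ v.toAdd.1 * z ^ v.toAdd.2) (by
      intro v v'
      simp only [toAdd_mul, Prod.fst_add, Prod.snd_add, zpow_add]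
      have := ((hzc c0).zpow_zpow v'.toAdd.1 v.toAdd.2).eq
      rw [mul_assoc, mul_assoc, ← mul_assoc (c0 ^ v'.toAdd.1), this]
      simp only [mul_assoc])
  have hE : ∀ v, E v = c0 ^ v.toAdd.1 * z ^ v.toAdd.2 := fun v => rfl
  refine ⟨(MulEquiv.ofBijective E ⟨?_, ?_⟩).symm⟩
  · rw [injective_iff_map_eq_one]
    intro v hv
    rw [hE] at hv
    have h1 := congrArg ψ hv
    rw [map_mul, map_zpow, map_zpow, hψz, one_zpow, mul_one, map_one] at h1
    have h2 : v.toAdd.1 = 0 := by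
      have h3 := congrArg Multiplicative.toAdd h1
      rw [toAdd_zpow, toAdd_one, smul_eq_mul] at h3
      exact (mul_eq_zero.1 h3).resolve_right hc0
    rw [h2, zpow_zero, one_mul] at hv
    have h4 : v.toAdd.2 = 0 := by
      apply hθ
      have h5 := congrArg (fun c : ↥(Subgroup.centralizer {g}) => θ c.1) hv
      simpa [z] using h5
    apply Multiplicative.toAdd.injective
    exact Prod.ext h2 h4
  · intro c
    obtain ⟨n, hn⟩ := hgen c
    obtain ⟨m, hm⟩ := hψ (c0 ^ (-n) * c) (by rw [map_mul, map_zpow, hn]; group)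
    refine ⟨Multiplicative.ofAdd (n, m), ?_⟩
    rw [hE]
    have : z ^ m = c0 ^ (-n) * c := Subtype.ext (by rw [hm]; simp [z])
    simp only [toAdd_ofAdd]
    rw [this]
    group
end

section
/- Let p, q ≥ 2 be integers, G_{p,q} = ⟨x, y | x^p = y^q⟩, and let τ be the automorphism with τ(x) = x⁻¹, τ(y) = y⁻¹. Suppose τ_g = ι_g ∘ τ has infinite order (equivalently g·τ(g) ≠ 1). Then the fixed subgroup Fix(τ_g) = {h : τ_g(h) = h} is infinite cyclic, contains g·τ(g), and contains every cyclic subgroup of G_{p,q} containing g·τ(g); that is, Fix(τ_g) is the maximal cyclic subgroup containing g·τ(g). -/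
/-- The fixed subgroup `Fix(φ) = {h : φ h = h}` of an automorphism `φ`. -/
def fixSubgroup {G : Type*} [Group G] (φ : G ≃* G) : Subgroup G where
  carrier := {h | φ h = h}
  one_mem' := map_one φ
  mul_mem' := fun ha hb => by
    simp only [Set.mem_setOf_eq] at *
    rw [map_mul, ha, hb]
  inv_mem' := fun ha => by
    simp only [Set.mem_setOf_eq] at *
    rw [map_inv, ha]

section ListAux

theorem list_comm_flatten {α : Type*} (w k : List α) (h : k ++ w = w ++ k) (N : ℕ) :
    k ++ (List.replicate N w).flatten = (List.replicate N w).flatten ++ k := by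
  induction N with
  | zero => simp
  | succ n ih =>
    rw [List.replicate_succ, List.flatten_cons, ← List.append_assoc, h, List.append_assoc, ih,
      List.append_assoc]

theorem list_comm_prefix {α : Type*} (w : List α) (hw : w ≠ []) (k k' : List α)
    (h : k ++ w = w ++ k) (h' : k' ++ w = w ++ k') (hl : k.length ≤ k'.length) : k <+: k' := by
  have hlen : k'.length ≤ ((List.replicate k'.length w).flatten).length := by
    have : 0 < w.length := List.length_pos_iff.mpr hw
    simp only [List.length_flatten, List.map_replicate, List.sum_replicate, smul_eq_mul]
    nlinarith
  have key : ∀ k'' : List α, k'' ++ w = w ++ k'' → k''.length ≤ k'.length →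
      k'' <+: (List.replicate k'.length w).flatten := by
    intro k'' h'' hl''
    have h1 : k'' <+: (List.replicate k'.length w).flatten ++ k'' := by
      rw [← list_comm_flatten w k'' h'']
      exact List.prefix_append _ _
    exact List.prefix_of_prefix_length_le h1 (List.prefix_append _ _) (hl''.trans hlen)
  exact List.prefix_of_prefix_length_le (key k h hl) (key k' h' le_rfl) hl

theorem list_comm_root {α : Type*} (w : List α) (hw : w ≠ []) :
    ∃ u : List α, ∀ k : List α, k ++ w = w ++ k → ∃ n : ℕ, k = (List.replicate n u).flatten := by
  classical
  have hex : ∃ n : ℕ, ∃ u : List α, u.length = n ∧ u ≠ [] ∧ u ++ w = w ++ u :=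
    ⟨_, w, rfl, hw, rfl⟩
  obtain ⟨u, hu1, hu2, hu3⟩ := Nat.find_spec hex
  refine ⟨u, ?_⟩
  have main : ∀ (m : ℕ) (k : List α), k.length ≤ m → k ++ w = w ++ k →
      ∃ n : ℕ, k = (List.replicate n u).flatten := by
    intro m
    induction m with
    | zero =>
      intro k hk _
      exact ⟨0, by simpa using hk⟩
    | succ m ih =>
      intro k hk hc
      by_cases hk0 : k = []
      · exact ⟨0, by simpa using hk0⟩
      have hle : u.length ≤ k.length := by
        rw [hu1]
        exact Nat.find_min' hex ⟨k, rfl, hk0, hc⟩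
      obtain ⟨r, rfl⟩ := list_comm_prefix w hw u k hu3 hc hle
      have hr : r ++ w = w ++ r := by
        rw [List.append_assoc, ← List.append_assoc w, ← hu3, List.append_assoc] at hc
        exact List.append_cancel_left hc
      have : 0 < u.length := List.length_pos_iff.mpr hu2
      rw [List.length_append] at hk
      obtain ⟨n, hn⟩ := ih r (by omega) hr
      exact ⟨n + 1, by rw [List.replicate_succ, List.flatten_cons, ← hn]⟩
  exact fun k hk => main _ k le_rfl hk

end ListAux

section FreeProd

open Monoid

open scoped Classical in
/-- The reduced word of an element of a free product, as a list. -/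
noncomputable def redList {ι : Type*} {M : ι → Type*} [∀ i, Group (M i)]
    (h : CoprodI M) : List (Σ i, M i) := (CoprodI.Word.equiv h).toList

/-- The product of a list of letters. -/
def listProd {ι : Type*} {M : ι → Type*} [∀ i, Group (M i)]
    (l : List (Σ i, M i)) : CoprodI M := (l.map fun s => CoprodI.of s.2).prod

variable {ι : Type*} {M : ι → Type*} [∀ i, Group (M i)]

theorem listProd_append (l k : List (Σ i, M i)) :
    listProd (l ++ k) = listProd l * listProd k := by
  simp [listProd]

theorem listProd_cons (s : Σ i, M i) (k : List (Σ i, M i)) :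
    listProd (s :: k) = CoprodI.of s.2 * listProd k := by
  simp [listProd]

theorem listProd_replicate (u : List (Σ i, M i)) (n : ℕ) :
    listProd (List.replicate n u).flatten = listProd u ^ n := by
  induction n with
  | zero => simp [listProd]
  | succ n ih => rw [List.replicate_succ, List.flatten_cons, listProd_append, ih, pow_succ']

theorem listProd_redList (h : CoprodI M) : listProd (redList h) = h := by
  classical
  exact CoprodI.Word.equiv.symm_apply_apply h

theorem redList_listProd (l : List (Σ i, M i)) (h1 : ∀ s ∈ l, s.2 ≠ 1)
    (h2 : l.IsChain fun s t => s.1 ≠ t.1) : redList (listProd l) = l := by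
  classical
  exact congrArg CoprodI.Word.toList (CoprodI.Word.equiv.apply_symm_apply ⟨l, h1, h2⟩)

theorem redList_ne_one (h : CoprodI M) : ∀ s ∈ redList h, s.2 ≠ 1 := by
  classical
  exact (CoprodI.Word.equiv h).ne_one

theorem redList_chain (h : CoprodI M) : (redList h).IsChain fun s t => s.1 ≠ t.1 := by
  classical
  exact (CoprodI.Word.equiv h).chain_ne

theorem redList_one : redList (1 : CoprodI M) = [] :=
  redList_listProd [] (by simp) (by simp)

theorem redList_mul (h k : CoprodI M)
    (hne : ∀ s ∈ (redList h).getLast?, ∀ t ∈ (redList k).head?, s.1 ≠ t.1) :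
    redList (h * k) = redList h ++ redList k := by
  conv_lhs => rw [← listProd_redList h, ← listProd_redList k, ← listProd_append]
  apply redList_listProd
  · intro s hs
    rcases List.mem_append.mp hs with hs | hs
    · exact redList_ne_one h s hs
    · exact redList_ne_one k s hs
  · exact List.isChain_append.mpr ⟨redList_chain h, redList_chain k, hne⟩

theorem redList_of_mul_le (i : ι) (m : M i) (h : CoprodI M) :
    (redList (CoprodI.of m * h)).length ≤ (redList h).length + 1 := by
  by_cases hm : m = 1
  · subst hm; simp
  have hof : redList (CoprodI.of m) = [⟨i, m⟩] := by
    have := redList_listProd [(⟨i, m⟩ : Σ i, M i)] (by simpa using hm) (by simp)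
    simpa [listProd] using this
  rcases hL : redList h with _ | ⟨⟨j, n⟩, t⟩
  · have : h = 1 := by rw [← listProd_redList h, hL]; rfl
    subst this
    simp [hof]
  · by_cases hij : i = j
    · subst hij
      have ht1 : ∀ s ∈ t, s.2 ≠ 1 := fun s hs => redList_ne_one h s (by rw [hL]; simp [hs])
      have hc : (⟨i, n⟩ :: t : List (Σ i, M i)).IsChain fun s t => s.1 ≠ t.1 := hL ▸ redList_chain h
      have ht := redList_listProd t ht1 hc.tail
      have hh : CoprodI.of m * h = CoprodI.of (m * n) * listProd t := by
        rw [← listProd_redList h, hL, listProd_cons, map_mul, mul_assoc]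
      rw [hh]
      by_cases hmn : m * n = 1
      · rw [hmn, map_one, one_mul, ht]; simp; omega
      · have := redList_listProd (⟨i, m * n⟩ :: t) (by
          intro s hs
          rcases List.mem_cons.mp hs with rfl | hs
          · exact hmn
          · exact ht1 s hs) (by
          rw [List.isChain_cons] at hc ⊢
          exact hc)
        rw [listProd_cons] at this
        rw [this]; simp
    · rw [redList_mul _ _ (by rw [hof, hL]; simpa using hij), hof, hL]
      simp

theorem redList_listProd_le (l : List (Σ i, M i)) : (redList (listProd l)).length ≤ l.length := by
  induction l with
  | nil => simp [listProd, redList_one]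
  | cons s l ih =>
    rw [listProd_cons, List.length_cons]
    exact (redList_of_mul_le _ _ _).trans (by omega)

/-- If the letters that meet come from the same factor, the length drops. -/
theorem listProd_merge_lt (l k : List (Σ i, M i)) (s t : Σ i, M i) (hs : s ∈ l.getLast?)
    (ht : t ∈ k.head?) (hst : s.1 = t.1) :
    (redList (listProd (l ++ k))).length < l.length + k.length := by
  obtain ⟨a, rfl⟩ := List.getLast?_eq_some_iff.mp hs
  obtain ⟨b, rfl⟩ := List.head?_eq_some_iff.mp ht
  obtain ⟨i, m⟩ := s
  obtain ⟨j, n⟩ := t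
  obtain rfl : i = j := hst
  have : listProd ((a ++ [⟨i, m⟩]) ++ (⟨i, n⟩ :: b)) = listProd (a ++ ⟨i, m * n⟩ :: b) := by
    simp [listProd, mul_assoc]
  rw [this]
  refine (redList_listProd_le _).trans_lt ?_
  simp only [List.length_append, List.length_cons, List.length_nil]
  omega

theorem redList_mul_lt (h k : CoprodI M) (s t : Σ i, M i) (hs : s ∈ (redList h).getLast?)
    (ht : t ∈ (redList k).head?) (hst : s.1 = t.1) :
    (redList (h * k)).length < (redList h).length + (redList k).length := by
  have := listProd_merge_lt _ _ s t hs ht hst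
  rwa [listProd_append, listProd_redList, listProd_redList] at this

theorem redList_comm (h k : CoprodI M) (hc : h * k = k * h)
    (hne : ∀ s ∈ (redList h).getLast?, ∀ t ∈ (redList k).head?, s.1 ≠ t.1) :
    redList h ++ redList k = redList k ++ redList h := by
  have h1 := redList_mul h k hne
  rw [← h1, hc]
  apply redList_mul
  intro s hs t ht hst
  have h2 := redList_mul_lt k h s t hs ht hst
  rw [← hc, h1, List.length_append] at h2
  omega

theorem centralizer_cycRed (c : CoprodI M) (hc0 : redList c ≠ [])
    (hcr : ∀ s ∈ (redList c).getLast?, ∀ t ∈ (redList c).head?, s.1 ≠ t.1) :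
    ∃ v : CoprodI M, ∀ h, h * c = c * h → h ∈ Subgroup.zpowers v := by
  obtain ⟨u, hu⟩ := list_comm_root (redList c) hc0
  have good : ∀ k, redList k ++ redList c = redList c ++ redList k →
      k ∈ Subgroup.zpowers (listProd u) := by
    intro k hk
    obtain ⟨n, hn⟩ := hu _ hk
    rw [← listProd_redList k, hn, listProd_replicate]
    exact Subgroup.npow_mem_zpowers _ _
  refine ⟨listProd u, fun h hh => ?_⟩
  by_cases hA : ∀ s ∈ (redList h).getLast?, ∀ t ∈ (redList c).head?, s.1 ≠ t.1
  · exact good h (redList_comm h c hh hA)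
  · push Not at hA
    obtain ⟨s, hs, t, ht, hst⟩ := hA
    have hinv : c * h⁻¹ = h⁻¹ * c := by
      rw [mul_inv_eq_iff_eq_mul, mul_assoc, ← hh, inv_mul_cancel_left]
    have hB : ∀ s ∈ (redList c).getLast?, ∀ t ∈ (redList h⁻¹).head?, s.1 ≠ t.1 := by
      intro s' hs' t' ht' hst'
      have h1 := redList_mul h h⁻¹ (by
        intro s₁ hs₁ t₁ ht₁ e
        obtain rfl : s₁ = s := Option.mem_unique hs₁ hs
        obtain rfl : t₁ = t' := Option.mem_unique ht₁ ht'
        exact hcr s' hs' t ht (by rw [hst', ← e, hst]))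
      rw [mul_inv_cancel, redList_one] at h1
      have h2 : redList h = [] := (List.append_eq_nil_iff.mp h1.symm).1
      rw [h2] at hs
      simp at hs
    have := good h⁻¹ (redList_comm c h⁻¹ hinv hB).symm
    simpa using this

theorem centralizer_cyclic (hM : ∀ i, ∀ m : M i, IsOfFinOrder m) (c : CoprodI M)
    (hc : ¬ IsOfFinOrder c) :
    ∃ v : CoprodI M, ∀ h, h * c = c * h → h ∈ Subgroup.zpowers v := by
  induction hn : (redList c).length using Nat.strong_induction_on generalizing c with
  | _ n ih =>
  have hc0 : redList c ≠ [] := by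
    intro h
    apply hc
    rw [← listProd_redList c, h]
    exact IsOfFinOrder.one
  by_cases hcr : ∀ s ∈ (redList c).getLast?, ∀ t ∈ (redList c).head?, s.1 ≠ t.1
  · exact centralizer_cycRed c hc0 hcr
  push Not at hcr
  obtain ⟨s, hs, t, ht, hst⟩ := hcr
  obtain ⟨b, hb⟩ := List.head?_eq_some_iff.mp ht
  have hcb : c = CoprodI.of t.2 * listProd b := by
    rw [← listProd_cons, ← hb, listProd_redList]
  have hb0 : b ≠ [] := by
    rintro rfl
    apply hc
    rw [hcb]
    simpa [listProd] using (CoprodI.of : M t.1 →* CoprodI M).isOfFinOrder (hM _ t.2)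
  have hsb : s ∈ b.getLast? := by
    rw [hb, List.getLast?_cons_of_ne_nil hb0] at hs
    exact hs
  have hlt := listProd_merge_lt b [t] s t hsb (by simp) hst
  have hconj : listProd (b ++ [t]) = (CoprodI.of t.2)⁻¹ * c * CoprodI.of t.2 := by
    rw [hcb, listProd_append]
    simp [listProd]
  rw [hconj] at hlt
  have hlen : (redList ((CoprodI.of t.2)⁻¹ * c * CoprodI.of t.2)).length < n := by
    rw [← hn, hb]
    simpa using hlt
  have hco : ¬ IsOfFinOrder ((CoprodI.of t.2)⁻¹ * c * CoprodI.of t.2) := by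
    intro hf
    apply hc
    have := (MulAut.conj (CoprodI.of t.2)).toMonoidHom.isOfFinOrder hf
    simpa [mul_assoc] using this
  obtain ⟨v, hv⟩ := ih _ hlen _ hco rfl
  refine ⟨CoprodI.of t.2 * v * (CoprodI.of t.2)⁻¹, fun h hh => ?_⟩
  obtain ⟨k, hk⟩ := hv ((CoprodI.of t.2)⁻¹ * h * CoprodI.of t.2) (by
    simp only [mul_assoc, mul_inv_cancel_left]
    rw [← mul_assoc h, hh, mul_assoc])
  refine ⟨k, ?_⟩
  simp only at hk ⊢
  rw [conj_zpow, hk]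
  group

end FreeProd

section TKGaux

theorem TKG_rel (p q : ℕ) : TKx p q ^ p = TKy p q ^ q := by
  have h : (PresentedGroup.mk ({FreeGroup.of true ^ p * (FreeGroup.of false ^ q)⁻¹} :
      Set (FreeGroup Bool))) (FreeGroup.of true ^ p * (FreeGroup.of false ^ q)⁻¹) = 1 :=
    PresentedGroup.one_of_mem (Set.mem_singleton _)
  rw [map_mul, map_inv, map_pow, map_pow, mul_inv_eq_one] at h
  exact h

theorem TKG_exists_hom {p q : ℕ} {H : Type*} [Group H] (a b : H) (hab : a ^ p = b ^ q) :
    ∃ f : TKG p q →* H, f (TKx p q) = a ∧ f (TKy p q) = b := by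
  have h : ∀ r ∈ ({FreeGroup.of true ^ p * (FreeGroup.of false ^ q)⁻¹} : Set (FreeGroup Bool)),
      FreeGroup.lift (fun i : Bool => if i then a else b) r = 1 := by
    intro r hr
    rw [Set.mem_singleton_iff] at hr
    subst hr
    simp [hab]
  refine ⟨PresentedGroup.toGroup h, ?_, ?_⟩
  · exact (PresentedGroup.toGroup.of h).trans (by simp)
  · exact (PresentedGroup.toGroup.of h).trans (by simp)

theorem TKG_hom_ext {p q : ℕ} {H : Type*} [Group H] (f k : TKG p q →* H)
    (hx : f (TKx p q) = k (TKx p q)) (hy : f (TKy p q) = k (TKy p q)) : f = k := by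
  refine PresentedGroup.ext (rels := {FreeGroup.of true ^ p * (FreeGroup.of false ^ q)⁻¹}) ?_
  intro b
  cases b
  · exact hy
  · exact hx

theorem TKG_central (p q : ℕ) (h : TKG p q) : Commute (TKx p q ^ p) h := by
  have : (MulAut.conj (TKx p q ^ p)).toMonoidHom = MonoidHom.id (TKG p q) := by
    apply TKG_hom_ext
    · simp only [MulEquiv.toMonoidHom_eq_coe, MonoidHom.coe_coe, MulAut.conj_apply, MonoidHom.id_apply]
      rw [mul_inv_eq_iff_eq_mul, (Commute.pow_self (TKx p q) p).eq]
    · simp only [MulEquiv.toMonoidHom_eq_coe, MonoidHom.coe_coe, MulAut.conj_apply, MonoidHom.id_apply]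
      rw [mul_inv_eq_iff_eq_mul, TKG_rel, (Commute.pow_self (TKy p q) q).eq]
  have h2 := DFunLike.congr_fun this h
  simp only [MulEquiv.toMonoidHom_eq_coe, MonoidHom.coe_coe, MulAut.conj_apply, MonoidHom.id_apply] at h2
  exact mul_inv_eq_iff_eq_mul.mp h2

theorem TKG_zinf {p q : ℕ} (hp : 2 ≤ p) (hq : 2 ≤ q) (k : ℤ) (h : (TKx p q ^ p) ^ k = 1) : k = 0 := by
  obtain ⟨f, hx, -⟩ := TKG_exists_hom (p := p) (q := q) (Multiplicative.ofAdd (q : ℤ))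
    (Multiplicative.ofAdd (p : ℤ)) (by rw [← ofAdd_nsmul, ← ofAdd_nsmul]; congr 1; simp [mul_comm])
  have h2 := congrArg f h
  rw [map_zpow, map_pow, hx, map_one, ← ofAdd_nsmul, ← ofAdd_zsmul, ofAdd_eq_one] at h2
  simp at h2
  omega

end TKGaux

section Quot

/-- The quotient of the torus knot group by the central element `x ^ p` has the property that
the centralizer of an element of infinite order lies in a cyclic group. -/
theorem TKG_quot (p q : ℕ) (hp : 2 ≤ p) (hq : 2 ≤ q) :
    ∃ (Q : Type) (_ : Group Q) (π : TKG p q →* Q),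
      (∀ h, π h = 1 → h ∈ Subgroup.zpowers (TKx p q ^ p)) ∧
      (∀ c : Q, ¬ IsOfFinOrder c → ∃ v : Q, ∀ h, h * c = c * h → h ∈ Subgroup.zpowers v) := by
  let N : Subgroup (TKG p q) := Subgroup.zpowers (TKx p q ^ p)
  haveI hN : N.Normal := by
    constructor
    rintro n ⟨k, rfl⟩ g
    refine ⟨k, ?_⟩
    simp only
    rw [← ((TKG_central p q g).zpow_left k).eq, mul_inv_cancel_right]
  let x' : TKG p q ⧸ N := QuotientGroup.mk' N (TKx p q)
  let y' : TKG p q ⧸ N := QuotientGroup.mk' N (TKy p q)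
  have hx' : x' ^ p = 1 := by
    rw [← map_pow]
    exact (QuotientGroup.eq_one_iff _).mpr (Subgroup.mem_zpowers _)
  have hy' : y' ^ q = 1 := by
    rw [← map_pow, ← TKG_rel]
    exact (QuotientGroup.eq_one_iff _).mpr (Subgroup.mem_zpowers _)
  let e : Bool → TKG p q ⧸ N := fun b => if b then x' else y'
  have he : ∀ b, IsOfFinOrder (e b) := by
    intro b
    cases b
    · exact isOfFinOrder_iff_pow_eq_one.mpr ⟨q, by omega, hy'⟩
    · exact isOfFinOrder_iff_pow_eq_one.mpr ⟨p, by omega, hx'⟩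
  let F : Bool → Type := fun b => Subgroup.zpowers (e b)
  letI : ∀ b, Group (F b) := fun b => inferInstanceAs (Group (Subgroup.zpowers (e b)))
  let a : ∀ b, F b := fun b => (⟨e b, Subgroup.mem_zpowers _⟩ : Subgroup.zpowers (e b))
  have ha1 : a true ^ p = 1 := Subtype.ext hx'
  have ha2 : a false ^ q = 1 := Subtype.ext hy'
  obtain ⟨π, hπx, hπy⟩ := TKG_exists_hom (p := p) (q := q)
    (Monoid.CoprodI.of (a true) : Monoid.CoprodI F) (Monoid.CoprodI.of (a false))
    (by rw [← map_pow, ← map_pow, ha1, ha2, map_one, map_one])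
  refine ⟨Monoid.CoprodI F, inferInstance, π, ?_, ?_⟩
  · let σ : Monoid.CoprodI F →* TKG p q ⧸ N :=
      Monoid.CoprodI.lift (fun b => ((Subgroup.zpowers (e b)).subtype : F b →* TKG p q ⧸ N))
    have hσ : σ.comp π = QuotientGroup.mk' N := by
      apply TKG_hom_ext
      · rw [MonoidHom.comp_apply, hπx]
        exact Monoid.CoprodI.lift_of _ _
      · rw [MonoidHom.comp_apply, hπy]
        exact Monoid.CoprodI.lift_of _ _
    intro h hh
    have := DFunLike.congr_fun hσ h
    rw [MonoidHom.comp_apply, hh, map_one] at this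
    exact (QuotientGroup.eq_one_iff _).mp this.symm
  · intro c hc
    refine centralizer_cyclic ?_ c hc
    rintro b ⟨m, k, rfl⟩
    have := (he b).zpow (i := k)
    obtain ⟨n, hn, h1⟩ := isOfFinOrder_iff_pow_eq_one.mp this
    exact isOfFinOrder_iff_pow_eq_one.mpr ⟨n, hn, Subtype.ext h1⟩

end Quot

/-- If `τ_g = ι_g ∘ τ` has infinite order, then `Fix(τ_g)` is infinite cyclic, contains
`g·τ(g)`, and contains every cyclic subgroup containing `g·τ(g)`: it is the maximal
cyclic subgroup containing `g·τ(g)`. -/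
theorem TKG_fix_tau_g_infinite_order (p q : ℕ) (hp : 2 ≤ p) (hq : 2 ≤ q)
    (τ : MulAut (TKG p q))
    (hτx : τ (TKx p q) = (TKx p q)⁻¹) (hτy : τ (TKy p q) = (TKy p q)⁻¹)
    (g : TKG p q) (hinf : ¬ IsOfFinOrder (MulAut.conj g * τ)) :
    (∃ z : TKG p q, ¬ IsOfFinOrder z ∧
        fixSubgroup (MulAut.conj g * τ) = Subgroup.zpowers z) ∧
    g * τ g ∈ fixSubgroup (MulAut.conj g * τ) ∧
    ∀ w : TKG p q, g * τ g ∈ Subgroup.zpowers w →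
        Subgroup.zpowers w ≤ fixSubgroup (MulAut.conj g * τ) := by
  obtain ⟨Q, _, π, hker, hcent⟩ := TKG_quot p q hp hq
  set T : MulAut (TKG p q) := MulAut.conj g * τ with hT
  set c := g * τ g with hc
  set z := TKx p q ^ p with hz
  have hTapp : ∀ h, T h = g * τ h * g⁻¹ := fun h => rfl
  have hττ : ∀ h, τ (τ h) = h := by
    have : (τ * τ : MulAut (TKG p q)).toMonoidHom = MonoidHom.id _ := by
      apply TKG_hom_ext
      · change τ (τ (TKx p q)) = TKx p q
        rw [hτx, map_inv, hτx, inv_inv]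
      · change τ (τ (TKy p q)) = TKy p q
        rw [hτy, map_inv, hτy, inv_inv]
    exact fun h => DFunLike.congr_fun this h
  have hTT : T * T = MulAut.conj c := by
    ext h
    change T (T h) = c * h * c⁻¹
    rw [hTapp, hTapp, map_mul, map_mul, hττ, map_inv, hc]
    group
  have hTc : T c = c := by
    rw [hTapp, hc, map_mul, hττ]
    group
  have hTz : T z = z⁻¹ := by
    have h1 : τ z = z⁻¹ := by rw [hz, map_pow, hτx, inv_pow]
    rw [hTapp, h1, ← ((TKG_central p q g).inv_left).eq, mul_inv_cancel_right]
  have hzN : ∀ h, T h = h → π h = 1 → h = 1 := by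
    intro h h1 h2
    obtain ⟨k, rfl⟩ := hker h h2
    simp only at h1 ⊢
    rw [map_zpow, hTz, inv_zpow, inv_eq_iff_mul_eq_one, ← zpow_add] at h1
    have := TKG_zinf hp hq _ h1
    obtain rfl : k = 0 := by omega
    exact zpow_zero _
  have hTfin : ∀ n : ℕ, 0 < n → π c ^ n ≠ 1 := by
    intro n hn h
    rw [← map_pow] at h
    obtain ⟨k, hk⟩ := hker _ h
    simp only at hk
    apply hinf
    refine isOfFinOrder_iff_pow_eq_one.mpr ⟨2 * n, by omega, ?_⟩
    rw [pow_mul, pow_two, hTT, ← map_pow, ← hk]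
    ext h
    rw [MulAut.conj_apply, ((TKG_central p q h).zpow_left k).eq, mul_inv_cancel_right]
    rfl
  have hcinf : ¬ IsOfFinOrder (π c) := by
    intro h
    obtain ⟨n, hn, h1⟩ := isOfFinOrder_iff_pow_eq_one.mp h
    exact hTfin n hn h1
  obtain ⟨v, hv⟩ := hcent _ hcinf
  have hvinf : ¬ IsOfFinOrder v := by
    intro h
    obtain ⟨k, hk⟩ := hv (π c) rfl
    apply hcinf
    rw [← hk]
    exact h.zpow
  have hcomm : ∀ h, h * c = c * h → π h ∈ Subgroup.zpowers v := by
    intro h hh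
    apply hv
    rw [← map_mul, hh, map_mul]
  have hfixmem : ∀ h, h ∈ fixSubgroup T ↔ T h = h := fun h => Iff.rfl
  have hfix : ∀ h, T h = h → h * c = c * h := by
    intro h hh
    have h1 : (T * T) h = h := by rw [MulAut.mul_apply, hh, hh]
    rw [hTT, MulAut.conj_apply, mul_inv_eq_iff_eq_mul] at h1
    exact h1.symm
  have hcmem : c ∈ fixSubgroup T := hTc
  refine ⟨?_, hcmem, ?_⟩
  · let f : fixSubgroup T →* Subgroup.zpowers v :=
      (π.comp (fixSubgroup T).subtype).codRestrict _ (fun h => hcomm h.1 (hfix h.1 h.2))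
    have hf : Function.Injective f := by
      rw [injective_iff_map_eq_one]
      intro h hh
      exact Subtype.ext (hzN h.1 h.2 (congrArg Subtype.val hh))
    haveI : IsCyclic (fixSubgroup T) := isCyclic_of_injective f hf
    obtain ⟨w, hw⟩ := (Subgroup.isCyclic_iff_exists_zpowers_eq_top _).mp this
    refine ⟨w, ?_, hw.symm⟩
    intro hwf
    rw [← hw] at hcmem
    obtain ⟨k, hk⟩ := hcmem
    apply hcinf
    rw [← hk]
    exact π.isOfFinOrder hwf.zpow
  · rintro w ⟨k, hk⟩
    simp only at hk
    rw [Subgroup.zpowers_le, hfixmem]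
    have hk0 : k ≠ 0 := by
      rintro rfl
      apply hcinf
      rw [← hk, zpow_zero, map_one]
      exact IsOfFinOrder.one
    have hTw : T w ^ k = c := by rw [← map_zpow, hk, hTc]
    have hwc : w * c = c * w := by rw [← hk]; exact (Commute.self_zpow w k).eq
    have hTwc : T w * c = c * T w := by rw [← hTw]; exact (Commute.self_zpow (T w) k).eq
    obtain ⟨a, ha⟩ := hcomm w hwc
    obtain ⟨b, hb⟩ := hcomm (T w) hTwc
    simp only at ha hb
    have hab : v ^ (a * k) = v ^ (b * k) := by
      rw [zpow_mul, zpow_mul, ha, hb, ← map_zpow, ← map_zpow, hk, hTw]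
    have hab' : a = b := by
      have := injective_zpow_iff_not_isOfFinOrder.mpr hvinf hab
      exact mul_right_cancel₀ hk0 this
    have h1 : π (T w * w⁻¹) = 1 := by
      rw [map_mul, map_inv, ← ha, ← hb, hab', mul_inv_cancel]
    obtain ⟨m, hm⟩ := hker _ h1
    simp only at hm
    have hTw' : T w = z ^ m * w := by rw [hm, inv_mul_cancel_right]
    have h2 : z ^ (m * k) = 1 := by
      have h3 := hTw
      rw [hTw', ((TKG_central p q w).zpow_left m).mul_zpow, hk, ← zpow_mul] at h3
      exact mul_eq_right.mp h3
    have h3 := TKG_zinf hp hq _ h2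
    have hm0 : m = 0 := (mul_eq_zero.mp h3).resolve_right hk0
    rw [hTw', hm0, zpow_zero, one_mul]
end

section
/- Let p, q ≥ 2 be integers, G_{p,q} = ⟨x, y | x^p = y^q⟩, and let τ be the automorphism with τ(x) = x⁻¹, τ(y) = y⁻¹. If g ∈ G_{p,q} satisfies g·τ(g) = 1 (equivalently ι_g ∘ τ has finite order), then there exist h ∈ G_{p,q} and r ∈ ℤ such that g = h x^r τ(h)⁻¹ or g = h y^r τ(h)⁻¹. -/
namespace TKaux

open Monoid

/-- The exponent attached to a generator. -/
def ex (p q : ℕ) (b : Bool) : ℕ := if b then p else q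

/-- The generators. -/
def gen (p q : ℕ) (b : Bool) : TKG p q := if b then TKx p q else TKy p q

/-- The cyclic factors of the quotient by the centre. -/
abbrev M (p q : ℕ) (b : Bool) : Type := Multiplicative (ZMod (ex p q b))

/-- The central element. -/
def z (p q : ℕ) : TKG p q := TKx p q ^ p

theorem rel (p q : ℕ) : TKx p q ^ p = TKy p q ^ q := by
  have h : (PresentedGroup.mk
      ({FreeGroup.of true ^ p * (FreeGroup.of false ^ q)⁻¹} : Set (FreeGroup Bool)))
      (FreeGroup.of true ^ p * (FreeGroup.of false ^ q)⁻¹) = 1 :=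
    PresentedGroup.one_of_mem (Set.mem_singleton _)
  rw [map_mul, map_inv, map_pow, map_pow, mul_inv_eq_one] at h
  exact h

theorem gen_pow (p q : ℕ) (b : Bool) : gen p q b ^ ex p q b = z p q := by
  cases b
  · simp [gen, ex, z, rel]
  · simp [gen, ex, z]

theorem gen_ind (p q : ℕ) {S : Subgroup (TKG p q)} (h : ∀ b, gen p q b ∈ S) (g : TKG p q) :
    g ∈ S := by
  have h1 : Subgroup.closure (Set.range (PresentedGroup.of (rels :=
    ({FreeGroup.of true ^ p * (FreeGroup.of false ^ q)⁻¹} : Set (FreeGroup Bool))))) = ⊤ :=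
    PresentedGroup.closure_range_of _
  have h2 : (⊤ : Subgroup (TKG p q)) ≤ S := by
    refine le_trans (le_of_eq h1.symm) ?_
    refine (Subgroup.closure_le _).2 ?_
    rintro _ ⟨b, rfl⟩
    have := h b
    cases b <;> exact this
  exact h2 (Subgroup.mem_top g)

theorem z_comm (p q : ℕ) (g : TKG p q) : Commute (z p q) g := by
  have : g ∈ Subgroup.centralizer {z p q} := by
    apply gen_ind
    intro b
    rw [Subgroup.mem_centralizer_singleton_iff, ← gen_pow p q b]
    exact ((Commute.refl (gen p q b)).pow_right _)
  rw [Subgroup.mem_centralizer_singleton_iff] at this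
  exact this.symm

/-- The projection to the free product of cyclic groups. -/
noncomputable def proj (p q : ℕ) : TKG p q →* CoprodI (M p q) :=
  PresentedGroup.toGroup
    (f := fun b => CoprodI.of (M := M p q) (i := b) (Multiplicative.ofAdd 1)) (by
    intro r hr
    rw [Set.mem_singleton_iff] at hr
    subst hr
    rw [map_mul, map_inv, map_pow, map_pow, FreeGroup.lift_apply_of, FreeGroup.lift_apply_of,
      ← map_pow CoprodI.of, ← map_pow CoprodI.of, ← ofAdd_nsmul, ← ofAdd_nsmul]
    have h1 : p • (1 : ZMod (ex p q true)) = 0 := by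
      rw [nsmul_one]; exact ZMod.natCast_self (ex p q true)
    have h2 : q • (1 : ZMod (ex p q false)) = 0 := by
      rw [nsmul_one]; exact ZMod.natCast_self (ex p q false)
    rw [h1, h2]
    simp)

theorem proj_gen (p q : ℕ) (b : Bool) :
    proj p q (gen p q b) = CoprodI.of (M := M p q) (i := b) (Multiplicative.ofAdd 1) := by
  cases b <;> exact PresentedGroup.toGroup.of _

theorem proj_z (p q : ℕ) : proj p q (z p q) = 1 := by
  rw [← gen_pow p q true, map_pow, proj_gen, ← map_pow, ← ofAdd_nsmul]
  simp

/-- The lift of a syllable. -/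
def syl (p q : ℕ) (s : Σ b, M p q b) : TKG p q := gen p q s.1 ^ (s.2.toAdd.val)

/-- The lift of a word. -/
def P (p q : ℕ) (l : List (Σ b, M p q b)) : TKG p q := (l.map (syl p q)).prod

theorem ex_ne {p q : ℕ} (hp : 2 ≤ p) (hq : 2 ≤ q) (b : Bool) : NeZero (ex p q b) := by
  constructor
  cases b <;> simp [ex] <;> omega

theorem proj_syl {p q : ℕ} (hp : 2 ≤ p) (hq : 2 ≤ q) (s : Σ b, M p q b) :
    proj p q (syl p q s) = CoprodI.of s.2 := by
  have := ex_ne hp hq s.1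
  rw [syl, map_pow, proj_gen, ← map_pow, ← ofAdd_nsmul]
  simp

theorem proj_P {p q : ℕ} (hp : 2 ≤ p) (hq : 2 ≤ q) (w : CoprodI.Word (M p q)) :
    proj p q (P p q w.toList) = w.prod := by
  rw [P, map_list_prod, List.map_map, CoprodI.Word.prod]
  congr 1
  apply List.map_congr_left
  intro s _
  exact proj_syl hp hq s

theorem P_rcons (p q : ℕ) {b : Bool} (r : CoprodI.Word.Pair (M p q) b) :
    P p q (CoprodI.Word.rcons r).toList = syl p q ⟨b, r.head⟩ * P p q r.tail.toList := by
  classical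
  rw [CoprodI.Word.rcons]
  split_ifs with h
  · simp [syl, h]
  · simp [CoprodI.Word.cons, P]

theorem syl_zpow {p q : ℕ} (hp : 2 ≤ p) (hq : 2 ≤ q) (b : Bool) (j : ℤ) (m : M p q b) :
    ∃ (k : ℤ) (m' : M p q b), gen p q b ^ j * syl p q ⟨b, m⟩ = z p q ^ k * syl p q ⟨b, m'⟩ := by
  have := ex_ne hp hq b
  set t : ℤ := j + (m.toAdd.val : ℤ) with ht
  refine ⟨t / (ex p q b), Multiplicative.ofAdd ((t : ℤ) : ZMod (ex p q b)), ?_⟩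
  have h1 : (((t : ℤ) : ZMod (ex p q b)).val : ℤ) = t % (ex p q b) := ZMod.val_intCast t
  rw [← gen_pow p q b]
  simp only [syl, toAdd_ofAdd]
  rw [← zpow_natCast, ← zpow_natCast, ← zpow_natCast, ← zpow_add, h1, ← zpow_mul, ← zpow_add,
    Int.mul_ediv_add_emod]

theorem normal_form {p q : ℕ} (hp : 2 ≤ p) (hq : 2 ≤ q) (g : TKG p q) :
    ∃ (k : ℤ) (w : CoprodI.Word (M p q)), g = z p q ^ k * P p q w.toList := by
  classical
  let T : Set (TKG p q) := {g | ∃ (k : ℤ) (w : CoprodI.Word (M p q)), g = z p q ^ k * P p q w.toList}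
  have step : ∀ b (j : ℤ), ∀ g ∈ T, gen p q b ^ j * g ∈ T := by
    rintro b j _ ⟨k, w, rfl⟩
    obtain ⟨r, rfl⟩ : ∃ r, CoprodI.Word.rcons r = w :=
      ⟨CoprodI.Word.equivPair b w, (CoprodI.Word.equivPair b).symm_apply_apply w⟩
    obtain ⟨k', m', h⟩ := syl_zpow hp hq b j r.head
    refine ⟨k + k', CoprodI.Word.rcons ⟨m', r.tail, r.fstIdx_ne⟩, ?_⟩
    rw [P_rcons, P_rcons, zpow_add, mul_assoc, ← mul_assoc (z p q ^ k'), ← h]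
    simp only [← mul_assoc]
    rw [((z_comm p q (gen p q b ^ j)).zpow_left k).eq]
  let S : Subgroup (TKG p q) :=
    { carrier := {g | (∀ t ∈ T, g * t ∈ T) ∧ (∀ t ∈ T, g⁻¹ * t ∈ T)}
      one_mem' := by simp
      mul_mem' := by
        rintro a b ⟨h1, h2⟩ ⟨h3, h4⟩
        refine ⟨fun t ht => ?_, fun t ht => ?_⟩
        · rw [mul_assoc]; exact h1 _ (h3 _ ht)
        · rw [mul_inv_rev, mul_assoc]; exact h4 _ (h2 _ ht)
      inv_mem' := by
        rintro a ⟨h1, h2⟩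
        exact ⟨h2, by simpa using h1⟩ }
  have hg : g ∈ S := by
    apply gen_ind
    intro b
    refine ⟨fun t ht => ?_, fun t ht => ?_⟩
    · simpa using step b 1 t ht
    · simpa using step b (-1) t ht
  have h1 : (1 : TKG p q) ∈ T := ⟨0, CoprodI.Word.empty, by simp [P, CoprodI.Word.empty]⟩
  have h2 := hg.1 1 h1
  rw [mul_one] at h2
  exact h2

/-- The reversed word. -/
def rev {p q : ℕ} (w : CoprodI.Word (M p q)) : CoprodI.Word (M p q) where
  toList := w.toList.reverse
  ne_one l hl := w.ne_one l (List.mem_reverse.1 hl)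
  chain_ne := by
    rw [List.isChain_reverse]
    exact w.chain_ne.imp fun _ _ h => h.symm

theorem tau_syl {p q : ℕ} (τ : MulAut (TKG p q)) (hτ : ∀ b, τ (gen p q b) = (gen p q b)⁻¹)
    (s : Σ b, M p q b) : (τ (syl p q s))⁻¹ = syl p q s := by
  rw [syl, map_pow, hτ, inv_pow, inv_inv]

theorem tau_P {p q : ℕ} (τ : MulAut (TKG p q)) (hτ : ∀ b, τ (gen p q b) = (gen p q b)⁻¹)
    (l : List (Σ b, M p q b)) : (τ (P p q l))⁻¹ = P p q l.reverse := by
  induction l with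
  | nil => simp [P]
  | cons s l ih =>
    have h : P p q (s :: l) = syl p q s * P p q l := by simp [P]
    rw [h, map_mul, mul_inv_rev, ih, tau_syl τ hτ]
    simp [P]

theorem pal {p q : ℕ} (τ : MulAut (TKG p q)) (hτ : ∀ b, τ (gen p q b) = (gen p q b)⁻¹)
    (l : List (Σ b, M p q b)) (hl : l.Palindrome) :
    ∃ (h : TKG p q) (r : ℤ) (b : Bool), P p q l = h * gen p q b ^ r * (τ h)⁻¹ := by
  induction hl with
  | nil => exact ⟨1, 0, true, by simp [P]⟩
  | singleton s => exact ⟨1, s.2.toAdd.val, s.1, by simp [P, syl]⟩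
  | @cons_concat s l _ ih =>
    obtain ⟨h, r, b, e⟩ := ih
    refine ⟨syl p q s * h, r, b, ?_⟩
    have h1 : P p q (s :: (l ++ [s])) = syl p q s * P p q l * syl p q s := by simp [P, mul_assoc]
    rw [h1, e, map_mul, mul_inv_rev, tau_syl τ hτ]
    simp only [mul_assoc]

theorem main {p q : ℕ} (τ : MulAut (TKG p q)) (hτ : ∀ b, τ (gen p q b) = (gen p q b)⁻¹)
    (hp : 2 ≤ p) (hq : 2 ≤ q) (g : TKG p q) (hg : g * τ g = 1) :
    ∃ (h : TKG p q) (r : ℤ) (b : Bool), g = h * gen p q b ^ r * (τ h)⁻¹ := by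
  classical
  obtain ⟨k, w, rfl⟩ := normal_form hp hq g
  have h1 := eq_inv_of_mul_eq_one_left hg
  have hz : (τ (z p q))⁻¹ = z p q := by
    rw [← gen_pow p q true, map_pow, hτ, inv_pow, inv_inv]
  rw [map_mul, mul_inv_rev, tau_P τ hτ, map_zpow, ← inv_zpow, hz] at h1
  have h2 := congrArg (proj p q) h1
  rw [map_mul, map_mul, map_zpow, proj_z, one_zpow, one_mul, mul_one, proj_P hp hq,
    show w.toList.reverse = (rev w).toList from rfl, proj_P hp hq] at h2
  have h3 : w = rev w := CoprodI.Word.equiv.symm.injective h2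
  have h4 : w.toList.reverse = w.toList := (congrArg CoprodI.Word.toList h3).symm
  obtain ⟨h, r, b, e⟩ := pal τ hτ _ (List.Palindrome.of_reverse_eq h4)
  refine ⟨h, ex p q b * k + r, b, ?_⟩
  rw [e, zpow_add, zpow_mul, zpow_natCast, gen_pow]
  simp only [← mul_assoc]
  rw [((z_comm p q h).zpow_left k).eq]

end TKaux


/-- If `g·τ(g) = 1` (i.e. `ι_g ∘ τ` has finite order), then `g = h x^r τ(h)⁻¹` or
`g = h y^r τ(h)⁻¹` for some `h ∈ G_{p,q}` and `r ∈ ℤ`. -/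
theorem TKG_finite_order_true_form (p q : ℕ) (hp : 2 ≤ p) (hq : 2 ≤ q)
    (τ : MulAut (TKG p q))
    (hτx : τ (TKx p q) = (TKx p q)⁻¹) (hτy : τ (TKy p q) = (TKy p q)⁻¹)
    (g : TKG p q) (hfin : g * τ g = 1) :
    ∃ (h : TKG p q) (r : ℤ),
      g = h * TKx p q ^ r * (τ h)⁻¹ ∨ g = h * TKy p q ^ r * (τ h)⁻¹ := by
  have hτ : ∀ b, τ (TKaux.gen p q b) = (TKaux.gen p q b)⁻¹ := by
    intro b
    cases b
    · exact hτy
    · exact hτx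
  obtain ⟨h, r, b, e⟩ := TKaux.main τ hτ hp hq g hfin
  refine ⟨h, r, ?_⟩
  cases b
  · exact Or.inr e
  · exact Or.inl e
end
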